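/- Every ideal of 𝒪_F coprime to 3 has a generator congruent to 1 modulo 3. -/

import Mathlib

open NumberField

namespace Stmt11

/-- Quadruples `(a, b, c, d)` stand for `a + b z + c z ^ 2 + d z ^ 3`. -/
abbrev Quad := ℤ × ℤ × ℤ × ℤ

def ev {R : Type*} [CommRing R] (z : R) (q : Quad) : R :=
  q.1 + q.2.1 * z + q.2.2.1 * z ^ 2 + q.2.2.2 * z ^ 3

/-- multiplication by `z` when `z ^ 4 = z ^ 2 - 1` -/
def mz (q : Quad) : Quad := (-q.2.2.2, q.1, q.2.1 + q.2.2.2, q.2.2.1)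

/-- multiplication by `1 - z` -/
def mu (q : Quad) : Quad := q - mz q

/-- multiplication by `2 z - z ^ 3`, a square root of `3` -/
def ms (q : Quad) : Quad := mz q + mz q - mz (mz (mz q))

def isZero (q : Quad) : Bool :=
  q.1 % 3 == 0 && q.2.1 % 3 == 0 && q.2.2.1 % 3 == 0 && q.2.2.2 % 3 == 0

def quad (a b c d : Fin 3) : Quad := ((a.1 : ℤ), (b.1 : ℤ), (c.1 : ℤ), (d.1 : ℤ))

theorem key : ∀ a b c d : Fin 3,
    (∃ i : Fin 12, ∃ j : Fin 8, isZero (mz^[i.1] (mu^[j.1] (quad a b c d)) - (1, 0, 0, 0)) = true) ∨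
      isZero (ms (quad a b c d)) = true := by
  decide +kernel

section
variable {R : Type*} [CommRing R] {z : R}

theorem ev_sub (p q : Quad) : ev z (p - q) = ev z p - ev z q := by
  simp only [ev, Prod.fst_sub, Prod.snd_sub]; push_cast; ring

theorem ev_add (p q : Quad) : ev z (p + q) = ev z p + ev z q := by
  simp only [ev, Prod.fst_add, Prod.snd_add]; push_cast; ring

theorem ev_mz (hz : z ^ 4 = z ^ 2 - 1) (q : Quad) : ev z (mz q) = z * ev z q := by
  simp only [ev, mz]; push_cast
  linear_combination (-(q.2.2.2 : R)) * hz

theorem ev_mu (hz : z ^ 4 = z ^ 2 - 1) (q : Quad) : ev z (mu q) = (1 - z) * ev z q := by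
  rw [mu, ev_sub, ev_mz hz]; ring

theorem ev_ms (hz : z ^ 4 = z ^ 2 - 1) (q : Quad) : ev z (ms q) = (2 * z - z ^ 3) * ev z q := by
  simp only [ms, ev_sub, ev_add, ev_mz hz]; ring

theorem ev_mz_iter (hz : z ^ 4 = z ^ 2 - 1) (i : ℕ) (q : Quad) : ev z (mz^[i] q) = z ^ i * ev z q := by
  induction i with
  | zero => simp
  | succ n ih => rw [Function.iterate_succ_apply', ev_mz hz, ih]; ring

theorem ev_mu_iter (hz : z ^ 4 = z ^ 2 - 1) (i : ℕ) (q : Quad) : ev z (mu^[i] q) = (1 - z) ^ i * ev z q := by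
  induction i with
  | zero => simp
  | succ n ih => rw [Function.iterate_succ_apply', ev_mu hz, ih]; ring

theorem dvd_ev {q : Quad} (h : isZero q = true) : (3 : R) ∣ ev z q := by
  obtain ⟨a, b, c, d⟩ := q
  simp only [isZero, Bool.and_eq_true, beq_iff_eq] at h
  obtain ⟨⟨⟨h1, h2⟩, h3⟩, h4⟩ := h
  obtain ⟨a, rfl⟩ := Int.dvd_of_emod_eq_zero h1
  obtain ⟨b, rfl⟩ := Int.dvd_of_emod_eq_zero h2
  obtain ⟨c, rfl⟩ := Int.dvd_of_emod_eq_zero h3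
  obtain ⟨d, rfl⟩ := Int.dvd_of_emod_eq_zero h4
  exact ⟨ev z (a, b, c, d), by simp only [ev]; push_cast; ring⟩

theorem exists_fin (a : ℤ) : ∃ (r : Fin 3) (k : ℤ), a = r.1 + 3 * k :=
  ⟨⟨(a % 3).toNat, by omega⟩, a / 3, by simp only; omega⟩

theorem reduce (hz : z ^ 4 = z ^ 2 - 1) (q : Quad) :
    (∃ u : R, IsUnit u ∧ (3 : R) ∣ u * ev z q - 1) ∨ (3 : R) ∣ (2 * z - z ^ 3) * ev z q := by
  obtain ⟨a, b, c, d⟩ := q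
  obtain ⟨a, a', rfl⟩ := exists_fin a
  obtain ⟨b, b', rfl⟩ := exists_fin b
  obtain ⟨c, c', rfl⟩ := exists_fin c
  obtain ⟨d, d', rfl⟩ := exists_fin d
  have e : ev z ((a.1 : ℤ) + 3 * a', (b.1 : ℤ) + 3 * b', (c.1 : ℤ) + 3 * c', (d.1 : ℤ) + 3 * d')
      = ev z (quad a b c d) + 3 * ev z (a', b', c', d') := by
    simp only [ev, quad]; push_cast; ring
  rw [e]
  rcases key a b c d with ⟨i, j, h⟩ | h
  · left
    have h := dvd_ev (z := z) h
    rw [ev_sub, ev_mz_iter hz, ev_mu_iter hz] at h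
    obtain ⟨y, hy⟩ := h
    have e1 : ev z (1, 0, 0, 0) = 1 := by simp [ev]
    rw [e1] at hy
    refine ⟨z ^ i.1 * (1 - z) ^ j.1, ?_,
      y + z ^ i.1 * (1 - z) ^ j.1 * ev z (a', b', c', d'), by linear_combination hy⟩
    refine IsUnit.mul (IsUnit.pow _ ?_) (IsUnit.pow _ ?_)
    · exact IsUnit.of_mul_eq_one (z - z ^ 3) (by linear_combination -hz)
    · exact IsUnit.of_mul_eq_one (z ^ 2 * (z + 1)) (by linear_combination -hz)
  · right
    have h := dvd_ev (z := z) h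
    rw [ev_ms hz] at h
    obtain ⟨y, hy⟩ := h
    exact ⟨y + (2 * z - z ^ 3) * ev z (a', b', c', d'), by linear_combination hy⟩

theorem exists_ev (hz : z ^ 4 = z ^ 2 - 1) {x : R} (hx : x ∈ Algebra.adjoin ℤ {z}) : ∃ q, x = ev z q := by
  induction hx using Algebra.adjoin_induction with
  | mem x hx => exact ⟨(0, 1, 0, 0), by simp_all [ev]⟩
  | algebraMap r => exact ⟨(r, 0, 0, 0), by simp [ev]⟩
  | add x y _ _ hx hy =>
    obtain ⟨p, rfl⟩ := hx
    obtain ⟨q, rfl⟩ := hy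
    exact ⟨p + q, (ev_add p q).symm⟩
  | mul x y _ _ hx hy =>
    obtain ⟨⟨a, b, c, d⟩, rfl⟩ := hx
    obtain ⟨q, rfl⟩ := hy
    have hs : ∀ (n : ℤ) (p : Quad), ev z (n * p.1, n * p.2.1, n * p.2.2.1, n * p.2.2.2)
        = n * ev z p := by
      intro n p; simp only [ev]; push_cast; ring
    refine ⟨_, Eq.symm (((((ev_add _ _).trans (congrArg₂ _ ((ev_add _ _).trans
      (congrArg₂ _ ((ev_add _ _).trans (congrArg₂ _ (hs a q) (hs b (mz q))))
        (hs c (mz (mz q))))) (hs d (mz (mz (mz q)))))))).trans ?_)⟩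
    simp only [ev_mz hz]
    simp only [ev]; ring

end

instance cycInst : IsCyclotomicExtension {12} ℚ (CyclotomicField 12 ℚ) := by
  have h := @CyclotomicField.isCyclotomicExtension 12 _ ℚ _ _
  convert! h

theorem pid : IsPrincipalIdealRing (𝓞 (CyclotomicField 12 ℚ)) := by
  apply RingOfIntegers.isPrincipalIdealRing_of_abs_discr_lt
  have ht : Nat.totient 12 = 4 := by decide
  have hp : Nat.primeFactors 12 = {2, 3} := by decide +kernel
  have hd : |discr (CyclotomicField 12 ℚ)| = 144 := by
    rw [Int.abs_eq_natAbs, IsCyclotomicExtension.Rat.natAbs_discr 12, ht, hp]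
    norm_num
  rw [hd, IsCyclotomicExtension.Rat.finrank 12,
    IsCyclotomicExtension.Rat.nrComplexPlaces_eq_totient_div_two 12, ht]
  have h4 : Nat.factorial 4 = 24 := rfl
  rw [h4]
  have := Real.pi_gt_three
  norm_num
  have h2 : (9.61 : ℝ) < Real.pi ^ 2 := by nlinarith [Real.pi_gt_d2]
  nlinarith

theorem zeta_rel {R : Type*} [CommRing R] [IsDomain R] {z : R} (h : IsPrimitiveRoot z 12) :
    z ^ 4 = z ^ 2 - 1 := by
  have h6 : z ^ 6 - 1 ≠ 0 := sub_ne_zero.2 (h.pow_ne_one_of_pos_of_lt (by norm_num) (by norm_num))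
  have h4 : z ^ 4 - 1 ≠ 0 := sub_ne_zero.2 (h.pow_ne_one_of_pos_of_lt (by norm_num) (by norm_num))
  have h2 : z ^ 2 + 1 ≠ 0 := fun h0 => h4 (by linear_combination (z ^ 2 - 1) * h0)
  have e : (z ^ 6 - 1) * ((z ^ 2 + 1) * (z ^ 4 - z ^ 2 + 1)) = 0 := by
    linear_combination h.pow_eq_one
  have := (mul_eq_zero.1 ((mul_eq_zero.1 e).resolve_left h6)).resolve_left h2
  linear_combination this

theorem three_not_unit (K : Type*) [Field K] [NumberField K] (x : 𝓞 K) : (3 : 𝓞 K) * x ≠ 1 := by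
  intro h
  have h1 := congrArg (Algebra.norm ℤ) h
  have h3 : (3 : 𝓞 K) = algebraMap ℤ (𝓞 K) 3 := by simp
  rw [map_mul, map_one, h3, Algebra.norm_algebraMap] at h1
  have hu : IsUnit ((3 : ℤ) ^ Module.finrank ℤ (𝓞 K)) := IsUnit.of_mul_eq_one _ h1
  rw [isUnit_pow_iff (Module.finrank_pos).ne'] at hu
  exact absurd (Int.isUnit_iff.1 hu) (by norm_num)

end Stmt11

open Stmt11 in
/-- Every ideal of `𝒪_F`, `F = ℚ(ζ₁₂)`, coprime to 3 has a generator
congruent to 1 modulo 3. -/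
theorem stmt11 (I : Ideal (𝓞 (CyclotomicField 12 ℚ)))
    (h3 : IsCoprime I (Ideal.span {(3 : 𝓞 (CyclotomicField 12 ℚ))})) :
    ∃ n : 𝓞 (CyclotomicField 12 ℚ), I = Ideal.span {n} ∧
      (3 : 𝓞 (CyclotomicField 12 ℚ)) ∣ n - 1 := by
  have := pid
  obtain ⟨α, hα⟩ := IsPrincipalIdealRing.principal I
  change I = Ideal.span {α} at hα
  subst hα
  rw [Ideal.isCoprime_span_singleton_iff] at h3
  have hζ := IsCyclotomicExtension.zeta_spec 12 ℚ (CyclotomicField 12 ℚ)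
  have hz := zeta_rel hζ.toInteger_isPrimitiveRoot
  have htop := IsCyclotomicExtension.Rat.adjoin_singleton_eq_top hζ
  generalize hζ.toInteger = z at hz htop
  obtain ⟨q, rfl⟩ := exists_ev hz (x := α) (by rw [htop]; trivial)
  rcases reduce hz q with ⟨u, hu, hd⟩ | hd
  · exact ⟨u * ev z q, (Ideal.span_singleton_mul_left_unit hu _).symm, hd⟩
  · exfalso
    have hs : (3 : 𝓞 (CyclotomicField 12 ℚ)) ∣ 2 * z - z ^ 3 := h3.symm.dvd_of_dvd_mul_right hd
    obtain ⟨y, hy⟩ := hs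
    apply three_not_unit _ (y ^ 2)
    have h30 : (3 : 𝓞 (CyclotomicField 12 ℚ)) ≠ 0 := by norm_num
    apply mul_left_cancel₀ h30
    linear_combination (-(2 * z - z ^ 3) - 3 * y) * hy + (z ^ 2 - 3) * hz
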